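/- There exists a convex function h ∈ C²(ℝ, ℝ) with h' and h'' bounded, such that h(m) = 0 for all m ∈ D and the function w_h satisfies: w_h ∈ C²(ℝ, ℝ), w_h'' is bounded below, and there exist θ* ∈ ℝ and η > 0 with (θ − θ*)·w_h'(θ) ≥ η·(θ − θ*)² for all θ ∈ ℝ. -/

import Mathlib

open MeasureTheory Real Filter Set
open scoped ENNReal NNReal

noncomputable section

/-- The unnormalized density of `ν_m`: `x ↦ exp(−(1/σ²)[V(x) + (x−m)²/2])`. -/
def nuDens (σ : ℝ) (V : ℝ → ℝ) (m x : ℝ) : ℝ :=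
  Real.exp (-(1 / σ ^ 2) * (V x + (x - m) ^ 2 / 2))

/-- The mean of `ν_m`: `f(m) = ∫ x ν_m(dx)`. -/
def fFun (σ : ℝ) (V : ℝ → ℝ) (m : ℝ) : ℝ :=
  (∫ x, x * nuDens σ V m x) / ∫ x, nuDens σ V m x

/-- A probability density on `ℝ` with finite second moment, integrable entropy and
integrable energy. -/
structure AdmissibleDensity1 (V₀ : ℝ → ℝ) (ρ : ℝ → ℝ) : Prop where
  meas : Measurable ρ
  nonneg : ∀ x, 0 ≤ ρ x
  total : (∫ x, ρ x) = 1
  mom2 : Integrable (fun x => ρ x * x ^ 2)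
  ent : Integrable (fun x => ρ x * Real.log (ρ x))
  energy : Integrable (fun x => ρ x * V₀ x)

/-- The mean `m_μ = ∫ x μ(x) dx` of a density on `ℝ`. -/
def densMean1 (ρ : ℝ → ℝ) : ℝ := ∫ x, ρ x * x

/-- The free energy `F_θ(μ) = ∫ (V₀(x) − xθ) μ(x) dx + h(m_μ) + ∫ μ log μ`. -/
def freeEnergy1 (V₀ h : ℝ → ℝ) (θ : ℝ) (ρ : ℝ → ℝ) : ℝ :=
  (∫ x, ρ x * (V₀ x - x * θ)) + h (densMean1 ρ) + ∫ x, ρ x * Real.log (ρ x)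

/-- `w(θ) = θ²/(2κ) + inf_μ F_θ(μ)`. -/
def wFun1 (V₀ h : ℝ → ℝ) (κ θ : ℝ) : ℝ :=
  θ ^ 2 / (2 * κ) +
    sInf {s : ℝ | ∃ ρ, AdmissibleDensity1 V₀ ρ ∧ s = freeEnergy1 V₀ h θ ρ}

lemma ConvexOn.add_deriv_mul_sub_le {f : ℝ → ℝ} (hf : ConvexOn ℝ univ f) {x : ℝ}
    (hx : DifferentiableAt ℝ f x) (y : ℝ) : f x + deriv f x * (y - x) ≤ f y := by
  rcases lt_trichotomy x y with h | h | h
  · have := hf.deriv_le_slope (mem_univ x) (mem_univ y) h hx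
    rw [slope_def_field, le_div_iff₀ (sub_pos.2 h)] at this
    linarith
  · simp [h]
  · have := hf.slope_le_deriv (mem_univ y) (mem_univ x) h hx
    rw [slope_def_field, div_le_iff₀ (sub_pos.2 h)] at this
    linarith

section GibbsMeasure

variable {U : ℝ → ℝ}

/-- `U` grows faster than every quadratic function. -/
def Superquadratic (U : ℝ → ℝ) : Prop :=
  ∀ N : ℝ, 0 < N → ∃ C : ℝ, ∀ x, N * x ^ 2 - C ≤ U x

lemma Superquadratic.half (hU : Superquadratic U) : Superquadratic (fun x => U x / 2) := by
  intro N hN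
  obtain ⟨C, hC⟩ := hU (2 * N) (by positivity)
  exact ⟨C / 2, fun x => by linarith [hC x]⟩

lemma integrable_exp_tilt (hc : Continuous U) (hU : Superquadratic U) (t : ℝ) :
    Integrable (fun x => exp (t * x - U x)) := by
  obtain ⟨C, hC⟩ := hU 2 two_pos
  refine ((integrable_exp_neg_mul_sq one_pos).const_mul (exp (C + t ^ 2))).mono'
    (by fun_prop) (ae_of_all _ fun x => ?_)
  rw [norm_of_nonneg (exp_pos _).le, ← exp_add]
  exact exp_le_exp.2 (by nlinarith [hC x, sq_nonneg (x - t / 2), sq_nonneg t])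

/-- The measure on `ℝ` with Lebesgue density `exp (-U)`. -/
def gibbsMeasure (U : ℝ → ℝ) : Measure ℝ :=
  volume.withDensity fun x => ENNReal.ofReal (exp (-U x))

lemma integral_gibbsMeasure (hc : Continuous U) (φ : ℝ → ℝ) :
    ∫ x, φ x ∂gibbsMeasure U = ∫ x, φ x * exp (-U x) := by
  rw [gibbsMeasure, integral_withDensity_eq_integral_toReal_smul (by fun_prop)
    (ae_of_all _ fun x => ENNReal.ofReal_lt_top)]
  simp [ENNReal.toReal_ofReal (exp_pos _).le, mul_comm]

lemma integrable_gibbsMeasure_iff (hc : Continuous U) (φ : ℝ → ℝ) :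
    Integrable φ (gibbsMeasure U) ↔ Integrable fun x => φ x * exp (-U x) := by
  rw [gibbsMeasure, integrable_withDensity_iff_integrable_smul' (by fun_prop)
    (ae_of_all _ fun x => ENNReal.ofReal_lt_top)]
  simp [ENNReal.toReal_ofReal (exp_pos _).le, mul_comm]

lemma mem_interior_integrableExpSet_gibbsMeasure (hc : Continuous U) (hU : Superquadratic U)
    (t : ℝ) : t ∈ interior (ProbabilityTheory.integrableExpSet id (gibbsMeasure U)) := by
  have : ProbabilityTheory.integrableExpSet id (gibbsMeasure U) = Set.univ := by
    refine Set.eq_univ_of_forall fun s => ?_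
    change Integrable (fun x => exp (s * x)) (gibbsMeasure U)
    rw [integrable_gibbsMeasure_iff hc]
    refine (integrable_exp_tilt hc hU s).congr (ae_of_all _ fun x => ?_)
    simp [← exp_add, sub_eq_add_neg]
  simp [this]

lemma integrable_pow_mul_exp_tilt (hc : Continuous U) (hU : Superquadratic U) (t : ℝ) (n : ℕ) :
    Integrable fun x => x ^ n * exp (t * x - U x) := by
  have := ProbabilityTheory.integrable_pow_mul_exp_of_mem_interior_integrableExpSet
    (mem_interior_integrableExpSet_gibbsMeasure hc hU t) n
  rw [integrable_gibbsMeasure_iff hc] at this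
  refine this.congr (ae_of_all _ fun x => ?_)
  simp [mul_assoc, ← exp_add, sub_eq_add_neg]

lemma integrable_potential_mul_exp_tilt (hc : Continuous U) (hU : Superquadratic U) (t : ℝ) :
    Integrable fun x => U x * exp (t * x - U x) := by
  obtain ⟨C, hC⟩ := hU 1 one_pos
  refine (((integrable_exp_tilt (hc.div_const 2) hU.half t).const_mul 2).add
    ((integrable_exp_tilt hc hU t).const_mul |C|)).mono' (by fun_prop) (ae_of_all _ fun x => ?_)
  have h1 : exp (t * x - U x / 2) = exp (U x / 2) * exp (t * x - U x) := by
    rw [← exp_add]; ring_nf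
  have h2 := add_one_le_exp (U x / 2)
  have h3 := exp_pos (U x / 2)
  have h4 : |U x| ≤ 2 * exp (U x / 2) + |C| :=
    abs_le.2 ⟨by nlinarith [hC x, le_abs_self C], by linarith [abs_nonneg C]⟩
  simp only [Pi.add_apply, norm_mul, Real.norm_eq_abs, abs_exp, h1]
  nlinarith [exp_pos (t * x - U x)]

/-- The log-partition function `t ↦ log ∫ exp (t x - U x) dx`. -/
def logPartition (U : ℝ → ℝ) : ℝ → ℝ :=
  ProbabilityTheory.cgf id (gibbsMeasure U)

lemma mgf_gibbsMeasure (hc : Continuous U) (t : ℝ) :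
    ProbabilityTheory.mgf id (gibbsMeasure U) t = ∫ x, exp (t * x - U x) := by
  rw [ProbabilityTheory.mgf, integral_gibbsMeasure hc]
  simp [← exp_add, sub_eq_add_neg]

lemma partition_pos (hc : Continuous U) (hU : Superquadratic U) (t : ℝ) :
    0 < ∫ x, exp (t * x - U x) :=
  integral_exp_pos (integrable_exp_tilt hc hU t)

lemma exp_logPartition (hc : Continuous U) (hU : Superquadratic U) (t : ℝ) :
    exp (logPartition U t) = ∫ x, exp (t * x - U x) := by
  rw [logPartition, ProbabilityTheory.cgf, mgf_gibbsMeasure hc, exp_log (partition_pos hc hU t)]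

lemma contDiff_logPartition (hc : Continuous U) (hU : Superquadratic U) (n : ℕ∞) :
    ContDiff ℝ n (logPartition U) :=
  contDiff_iff_contDiffAt.2 fun t => (ProbabilityTheory.analyticAt_cgf
    (mem_interior_integrableExpSet_gibbsMeasure hc hU t)).contDiffAt

lemma deriv_logPartition (hc : Continuous U) (hU : Superquadratic U) (t : ℝ) :
    deriv (logPartition U) t = (∫ x, x * exp (t * x - U x)) / ∫ x, exp (t * x - U x) := by
  rw [logPartition, ProbabilityTheory.deriv_cgf
    (mem_interior_integrableExpSet_gibbsMeasure hc hU t), mgf_gibbsMeasure hc,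
    integral_gibbsMeasure hc]
  simp [mul_assoc, ← exp_add, sub_eq_add_neg]

lemma deriv_deriv_logPartition (hc : Continuous U) (hU : Superquadratic U) (t : ℝ) :
    deriv (deriv (logPartition U)) t =
      (∫ x, (x - deriv (logPartition U) t) ^ 2 * exp (t * x - U x)) /
        ∫ x, exp (t * x - U x) := by
  have := ProbabilityTheory.iteratedDeriv_two_cgf_eq_integral
    (mem_interior_integrableExpSet_gibbsMeasure hc hU t)
  rw [iteratedDeriv_succ, iteratedDeriv_one, mgf_gibbsMeasure hc, integral_gibbsMeasure hc] at this
  simpa [logPartition, mul_assoc, ← exp_add, sub_eq_add_neg] using this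

lemma deriv_deriv_logPartition_nonneg (hc : Continuous U) (hU : Superquadratic U) (t : ℝ) :
    0 ≤ deriv (deriv (logPartition U)) t := by
  rw [deriv_deriv_logPartition hc hU]
  exact div_nonneg (integral_nonneg fun x => by positivity) (partition_pos hc hU t).le

lemma integrable_sub_sq_mul_exp_tilt (hc : Continuous U) (hU : Superquadratic U) (t a : ℝ) :
    Integrable fun x => (x - a) ^ 2 * exp (t * x - U x) := by
  refine (((integrable_pow_mul_exp_tilt hc hU t 2).sub
    ((integrable_pow_mul_exp_tilt hc hU t 1).const_mul (2 * a))).add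
    ((integrable_exp_tilt hc hU t).const_mul (a ^ 2))).congr (ae_of_all _ fun x => ?_)
  simp only [Pi.add_apply, Pi.sub_apply]
  ring

lemma deriv_deriv_logPartition_le (hc : Continuous U) (hU : Superquadratic U) (t a : ℝ) :
    deriv (deriv (logPartition U)) t ≤
      (∫ x, (x - a) ^ 2 * exp (t * x - U x)) / ∫ x, exp (t * x - U x) := by
  have hZ := partition_pos hc hU t
  rw [deriv_deriv_logPartition hc hU]
  refine div_le_div_of_nonneg_right ?_ hZ.le
  set m := deriv (logPartition U) t with hm
  have hmZ : ∫ x, x * exp (t * x - U x) = m * ∫ x, exp (t * x - U x) := by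
    rw [hm, deriv_logPartition hc hU, div_mul_cancel₀ _ hZ.ne']
  have i0 := integrable_exp_tilt hc hU t
  have i1 : Integrable fun x => x * exp (t * x - U x) := by
    simpa using integrable_pow_mul_exp_tilt hc hU t 1
  have im := integrable_sub_sq_mul_exp_tilt hc hU t m
  have i2 : Integrable fun x => 2 * (m - a) * (x * exp (t * x - U x)) +
      (a ^ 2 - m ^ 2) * exp (t * x - U x) := (i1.const_mul _).add (i0.const_mul _)
  have key : ∫ x, (x - a) ^ 2 * exp (t * x - U x) =
      (∫ x, (x - m) ^ 2 * exp (t * x - U x)) +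
        (2 * (m - a) * (∫ x, x * exp (t * x - U x))
          + (a ^ 2 - m ^ 2) * ∫ x, exp (t * x - U x)) := by
    rw [← integral_const_mul, ← integral_const_mul,
      ← integral_add (i1.const_mul _) (i0.const_mul _),
      ← integral_add im i2]
    congr with x
    ring
  rw [key, hmZ]
  nlinarith [mul_nonneg (sq_nonneg (m - a)) hZ.le]

/-- The derivative of the log-partition function of a superquadratic potential is sublinear. -/
lemma mul_deriv_logPartition_le (hc : Continuous U) (hU : Superquadratic U) {ε : ℝ} (hε : 0 < ε) :
    ∃ C : ℝ, ∀ t, t * deriv (logPartition U) t ≤ ε * t ^ 2 + C := by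
  set Λ := logPartition U with hΛ
  have hd : Differentiable ℝ Λ := (contDiff_logPartition hc hU 1).differentiable (by simp)
  have hmono : Monotone (deriv Λ) := by
    have : Differentiable ℝ (deriv Λ) :=
      ((contDiff_succ_iff_deriv (n := 1)).1 (contDiff_logPartition hc hU 2)).2.2.differentiable
        (by simp)
    exact monotone_of_deriv_nonneg this (deriv_deriv_logPartition_nonneg hc hU)
  have hconv : ConvexOn ℝ univ Λ := Monotone.convexOn_univ_of_deriv hd hmono
  have htan : ∀ s t : ℝ, Λ s + deriv Λ s * (t - s) ≤ Λ t := fun s t =>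
    hconv.add_deriv_mul_sub_le (hd s) t
  obtain ⟨C, hC⟩ := hU (1 + 2 / ε) (by positivity)
  set B := exp C * ∫ x : ℝ, exp (-(1 : ℝ) * x ^ 2) with hB
  have hup : ∀ t, Λ t ≤ ε / 8 * t ^ 2 + log B := by
    intro t
    have hB0 : 0 < B :=
      mul_pos (exp_pos _) (integral_exp_pos (integrable_exp_neg_mul_sq one_pos))
    have : exp (Λ t) ≤ exp (ε / 8 * t ^ 2) * B := by
      rw [hΛ, exp_logPartition hc hU, hB, ← mul_assoc, ← exp_add, ← integral_const_mul]
      refine integral_mono (integrable_exp_tilt hc hU t)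
        ((integrable_exp_neg_mul_sq one_pos).const_mul _) fun x => ?_
      simp only [← exp_add]
      refine exp_le_exp.2 ?_
      have h1 : t * x ≤ ε / 8 * t ^ 2 + 2 / ε * x ^ 2 := by
        have : ε / 8 * t ^ 2 + 2 / ε * x ^ 2 - t * x = ε / 8 * (t - 4 / ε * x) ^ 2 := by
          field_simp
          ring
        nlinarith [mul_nonneg hε.le (sq_nonneg (t - 4 / ε * x))]
      linarith [hC x]
    rw [← exp_log hB0, ← exp_add] at this
    exact exp_le_exp.1 this
  refine ⟨log B - Λ 0 + (deriv Λ 0) ^ 2 / (2 * ε), fun t => ?_⟩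
  have h1 := htan t (2 * t)
  have h2 := hup (2 * t)
  have h3 := htan 0 t
  have h4 : -(deriv Λ 0 * t) ≤ ε / 2 * t ^ 2 + deriv Λ 0 ^ 2 / (2 * ε) := by
    have : ε / 2 * t ^ 2 + deriv Λ 0 ^ 2 / (2 * ε) + deriv Λ 0 * t =
        (ε * t + deriv Λ 0) ^ 2 / (2 * ε) := by
      field_simp
      ring
    have : 0 ≤ (ε * t + deriv Λ 0) ^ 2 / (2 * ε) := by positivity
    linarith
  nlinarith

end GibbsMeasure

section VarianceBound

lemma integral_sq_sub_mul_gaussian_eq_zero {r : ℝ} (hr : 0 < r) (a : ℝ) :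
    Integrable (fun x : ℝ => ((x - a) ^ 2 - 1 / r) * exp (-(r / 2) * (x - a) ^ 2)) ∧
      ∫ x : ℝ, ((x - a) ^ 2 - 1 / r) * exp (-(r / 2) * (x - a) ^ 2) = 0 := by
  have hr2 : 0 < r / 2 := by positivity
  have i0 := integrable_exp_neg_mul_sq hr2
  have i1 := integrable_mul_exp_neg_mul_sq hr2
  have i2 : Integrable fun x : ℝ => x ^ 2 * exp (-(r / 2) * x ^ 2) := by
    simpa using integrable_rpow_mul_exp_neg_mul_sq hr2 (s := 2) (by norm_num)
  have j : Integrable fun x : ℝ => (x ^ 2 - 1 / r) * exp (-(r / 2) * x ^ 2) :=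
    (i2.sub (i0.const_mul (1 / r))).congr (ae_of_all _ fun x => by
      simp only [Pi.sub_apply]
      ring)
  refine ⟨j.comp_sub_right a, ?_⟩
  rw [integral_sub_right_eq_self (fun x : ℝ => (x ^ 2 - 1 / r) * exp (-(r / 2) * x ^ 2)) a]
  refine integral_eq_zero_of_hasDerivAt_of_integrable
    (f := fun x => -(1 / r) * (x * exp (-(r / 2) * x ^ 2))) (fun x => ?_) j (i1.const_mul _)
  have h1 : HasDerivAt (fun x : ℝ => -(r / 2) * x ^ 2) (-(r / 2) * (2 * x)) x := by
    simpa using (hasDerivAt_pow 2 x).const_mul (-(r / 2))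
  refine (((hasDerivAt_id x).mul h1.exp).const_mul (-(1 / r))).congr_deriv ?_
  simp only [id]
  field_simp
  ring

lemma ConvexOn.sub_le_sub_of_interval_lt {ψ : ℝ → ℝ} (hψ : ConvexOn ℝ univ ψ) {c a b : ℝ}
    (hc : 0 < c) (hab : a + 2 * c < b) : ψ (a + c) - ψ (a - c) ≤ ψ (b + c) - ψ (b - c) := by
  have h1 := hψ.slope_mono_adjacent (mem_univ (a - c)) (mem_univ (b - c))
    (show a - c < a + c by linarith) (show a + c < b - c by linarith)
  have h2 := hψ.slope_mono_adjacent (mem_univ (a + c)) (mem_univ (b + c))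
    (show a + c < b - c by linarith) (show b - c < b + c by linarith)
  have h3 := h1.trans h2
  rw [show a + c - (a - c) = 2 * c by ring, show b + c - (b - c) = 2 * c by ring,
    div_le_div_iff_of_pos_right (by positivity)] at h3
  exact h3

lemma ConvexOn.sq_sub_mul_nonneg {χ : ℝ → ℝ} (hχ : ConvexOn ℝ univ χ) {a c : ℝ} (hc : 0 < c)
    (hac : χ (a + c) = χ (a - c)) (x : ℝ) : 0 ≤ ((x - a) ^ 2 - c ^ 2) * (χ x - χ (a + c)) := by
  rcases lt_or_ge x (a - c) with h | h
  · have := hχ.slope_mono_adjacent (mem_univ x) (mem_univ (a + c)) h (by linarith)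
    rw [hac, sub_self, zero_div, div_le_iff₀ (by linarith)] at this
    exact mul_nonneg (by nlinarith) (by linarith)
  rcases lt_or_ge (a + c) x with h' | h'
  · have := hχ.slope_mono_adjacent (mem_univ (a - c)) (mem_univ x) (by linarith) h'
    rw [hac, sub_self, zero_div, le_div_iff₀ (by linarith)] at this
    exact mul_nonneg (by nlinarith) (by linarith)
  · have : χ x ≤ max (χ (a - c)) (χ (a + c)) :=
      hχ.le_max_of_mem_Icc (mem_univ _) (mem_univ _) ⟨h, h'⟩
    rw [hac, max_self] at this
    exact mul_nonneg_of_nonpos_of_nonpos (by nlinarith) (by linarith)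

/-- A strongly convex function takes equal values at the ends of some interval of given length. -/
lemma StrongConvexOn.exists_add_eq_sub {W : ℝ → ℝ} {r : ℝ} (hr : 0 < r)
    (hW : StrongConvexOn univ r W) {c : ℝ} (hc : 0 < c) (t : ℝ) :
    ∃ a, W (a + c) - t * (a + c) = W (a - c) - t * (a - c) := by
  have hψ := strongConvexOn_iff_convex.1 hW
  set ψ : ℝ → ℝ := fun x => W x - r / 2 * ‖x‖ ^ 2 with hψdef
  have hψc : Continuous ψ := continuousOn_univ.1 (hψ.continuousOn isOpen_univ)
  have hWψ : ∀ x, W x = ψ x + r / 2 * x ^ 2 := fun x => by simp [hψdef]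
  have hD : Continuous fun a => ψ (a + c) - ψ (a - c) + 2 * r * c * a - 2 * t * c := by fun_prop
  set E := ψ (0 + c) - ψ (0 - c) with hE
  set b := 2 * c + 1 + |E - 2 * t * c| / (2 * r * c) with hb
  have hrc : 0 < 2 * r * c := by positivity
  have hbc : |E - 2 * t * c| ≤ 2 * r * c * b := by
    have : 2 * r * c * b = 2 * r * c * (2 * c + 1) + |E - 2 * t * c| := by
      rw [hb]
      field_simp
    rw [this]
    have : 0 ≤ 2 * r * c * (2 * c + 1) := by positivity
    linarith
  have hb2 : 2 * c < b := by
    have : 0 ≤ |E - 2 * t * c| / (2 * r * c) := by positivity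
    linarith
  obtain ⟨a, ha⟩ := mem_range_of_exists_le_of_exists_ge hD (c := 0)
    ⟨-b, by
      have := hψ.sub_le_sub_of_interval_lt hc (show -b + 2 * c < 0 by linarith)
      linarith [le_abs_self (E - 2 * t * c)]⟩
    ⟨b, by
      have := hψ.sub_le_sub_of_interval_lt hc (show 0 + 2 * c < b by linarith)
      linarith [neg_abs_le (E - 2 * t * c)]⟩
  refine ⟨a, ?_⟩
  simp only [hWψ]
  simp only at ha
  linarith

lemma StrongConvexOn.exists_integral_sub_sq_le {W : ℝ → ℝ} {r : ℝ} (hr : 0 < r)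
    (hW : StrongConvexOn univ r W) (hc : Continuous W) (hs : Superquadratic W) (t : ℝ) :
    ∃ a, ∫ x, (x - a) ^ 2 * exp (t * x - W x) ≤ 1 / r * ∫ x, exp (t * x - W x) := by
  have hc0 : 0 < √(1 / r) := by positivity
  obtain ⟨a, ha⟩ := hW.exists_add_eq_sub hr hc0 t
  refine ⟨a, ?_⟩
  set c := √(1 / r)
  have hc2 : c ^ 2 = 1 / r := Real.sq_sqrt (by positivity)
  set χ : ℝ → ℝ := fun x => W x - t * x - r / 2 * (x - a) ^ 2 with hχ
  have hconv : ConvexOn ℝ univ χ := by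
    have hlin : ConvexOn ℝ univ fun x : ℝ => (r * a - t) * x + -(r / 2 * a ^ 2) :=
      ((LinearMap.mulLeft ℝ (r * a - t)).convexOn convex_univ).add_const _
    refine ((strongConvexOn_iff_convex.1 hW).add hlin).congr fun x _ => ?_
    simp only [Pi.add_apply, hχ, Real.norm_eq_abs, sq_abs]
    ring
  have hac : χ (a + c) = χ (a - c) := by
    simp only [hχ]
    linear_combination ha
  obtain ⟨gi, g0⟩ := integral_sq_sub_mul_gaussian_eq_zero hr a
  have i0 := integrable_exp_tilt hc hs t
  have i2 := integrable_sub_sq_mul_exp_tilt hc hs t a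
  have key : ∫ x, ((x - a) ^ 2 * exp (t * x - W x) - 1 / r * exp (t * x - W x)) ≤
      ∫ x, exp (-χ (a + c)) * (((x - a) ^ 2 - 1 / r) * exp (-(r / 2) * (x - a) ^ 2)) := by
    refine integral_mono (i2.sub (i0.const_mul _)) (gi.const_mul _) fun x => ?_
    have h1 : exp (t * x - W x) = exp (-χ x) * exp (-(r / 2) * (x - a) ^ 2) := by
      rw [← exp_add]
      simp only [hχ]
      ring_nf
    have h2 : ((x - a) ^ 2 - 1 / r) * exp (-χ x) ≤ ((x - a) ^ 2 - 1 / r) * exp (-χ (a + c)) := by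
      have := hconv.sq_sub_mul_nonneg hc0 hac x
      rw [hc2] at this
      rcases le_total ((x - a) ^ 2) (1 / r) with h | h
      · rcases h.eq_or_lt with h | h
        · simp [h]
        · refine mul_le_mul_of_nonpos_left (exp_le_exp.2 ?_) (by linarith)
          nlinarith
      · rcases h.eq_or_lt with h | h
        · simp [h]
        · refine mul_le_mul_of_nonneg_left (exp_le_exp.2 ?_) (by linarith)
          nlinarith
    simp only [h1]
    nlinarith [exp_pos (-(r / 2) * (x - a) ^ 2)]
  rw [integral_const_mul, g0, mul_zero, integral_sub i2 (i0.const_mul _),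
    integral_const_mul] at key
  linarith

/-- The log-partition function of a bounded perturbation of a strongly convex potential has
bounded second derivative. -/
lemma exists_deriv_deriv_logPartition_le {U W : ℝ → ℝ} (hc : Continuous U)
    (hU : Superquadratic U) {r B : ℝ} (hr : 0 < r) (hW : StrongConvexOn univ r W)
    (hB : ∀ x, |U x - W x| ≤ B) :
    ∃ C : ℝ, ∀ t, deriv (deriv (logPartition U)) t ≤ C := by
  have hWc : Continuous W := by
    have h := continuousOn_univ.1 ((strongConvexOn_iff_convex.1 hW).continuousOn isOpen_univ)
    exact (h.add (show Continuous fun x : ℝ => r / 2 * ‖x‖ ^ 2 by fun_prop)).congr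
      fun x => sub_add_cancel _ _
  have hWs : Superquadratic W := by
    intro N hN
    obtain ⟨C, hC⟩ := hU N hN
    exact ⟨C + B, fun x => by linarith [hC x, le_of_abs_le (hB x)]⟩
  refine ⟨exp B * (1 / r * exp B), fun t => ?_⟩
  obtain ⟨a, ha⟩ := hW.exists_integral_sub_sq_le hr hWc hWs t
  refine (deriv_deriv_logPartition_le hc hU t a).trans ?_
  rw [div_le_iff₀ (partition_pos hc hU t)]
  calc ∫ x, (x - a) ^ 2 * exp (t * x - U x)
      ≤ ∫ x, exp B * ((x - a) ^ 2 * exp (t * x - W x)) := by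
        refine integral_mono (integrable_sub_sq_mul_exp_tilt hc hU t a)
          ((integrable_sub_sq_mul_exp_tilt hWc hWs t a).const_mul _) fun x => ?_
        have : exp (t * x - U x) ≤ exp B * exp (t * x - W x) := by
          rw [← exp_add]
          exact exp_le_exp.2 (by linarith [neg_le_of_abs_le (hB x)])
        simp only
        nlinarith [sq_nonneg (x - a)]
    _ ≤ exp B * (1 / r * ∫ x, exp (t * x - W x)) := by
        rw [integral_const_mul]
        gcongr
    _ ≤ exp B * (1 / r * ∫ x, exp B * exp (t * x - U x)) := by
        refine mul_le_mul_of_nonneg_left (mul_le_mul_of_nonneg_left (integral_mono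
          (integrable_exp_tilt hWc hWs t) ((integrable_exp_tilt hc hU t).const_mul _)
          fun x => ?_) (by positivity)) (exp_pos B).le
        simp only [← exp_add]
        exact exp_le_exp.2 (by linarith [le_of_abs_le (hB x)])
    _ = exp B * (1 / r * exp B) * ∫ x, exp (t * x - U x) := by
        rw [integral_const_mul]
        ring

end VarianceBound

section FreeEnergy

variable {U : ℝ → ℝ}

/-- The probability density proportional to `x ↦ exp (t x - U x)`. -/
def gibbsDensity (U : ℝ → ℝ) (t x : ℝ) : ℝ :=
  exp (t * x - U x - logPartition U t)

lemma gibbsDensity_eq (t x : ℝ) :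
    gibbsDensity U t x = exp (-logPartition U t) * exp (t * x - U x) := by
  rw [gibbsDensity, ← exp_add]
  ring_nf

lemma integral_gibbsDensity (hc : Continuous U) (hU : Superquadratic U) (t : ℝ) :
    ∫ x, gibbsDensity U t x = 1 := by
  simp only [gibbsDensity_eq]
  rw [integral_const_mul, ← exp_logPartition hc hU, ← exp_add, neg_add_cancel, exp_zero]

lemma integrable_gibbsDensity (hc : Continuous U) (hU : Superquadratic U) (t : ℝ) :
    Integrable (gibbsDensity U t) := by
  simp only [funext (gibbsDensity_eq (U := U) t)]
  exact (integrable_exp_tilt hc hU t).const_mul _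

lemma densMean1_gibbsDensity (hc : Continuous U) (hU : Superquadratic U) (t : ℝ) :
    densMean1 (gibbsDensity U t) = deriv (logPartition U) t := by
  rw [densMean1, deriv_logPartition hc hU, ← exp_logPartition hc hU, div_eq_inv_mul, ← exp_neg,
    ← integral_const_mul]
  congr with x
  rw [gibbsDensity_eq]
  ring

lemma admissibleDensity1_gibbsDensity (hc : Continuous U) (hU : Superquadratic U) (t : ℝ) :
    AdmissibleDensity1 U (gibbsDensity U t) := by
  have i0 := integrable_exp_tilt hc hU t
  have i1 : Integrable fun x => x * exp (t * x - U x) := by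
    simpa using integrable_pow_mul_exp_tilt hc hU t 1
  have i2 := integrable_pow_mul_exp_tilt hc hU t 2
  have iU := integrable_potential_mul_exp_tilt hc hU t
  refine ⟨?_, fun x => (exp_pos _).le, integral_gibbsDensity hc hU t, ?_, ?_, ?_⟩
  · unfold gibbsDensity
    have := hc.measurable
    fun_prop
  · refine (i2.const_mul (exp (-logPartition U t))).congr (ae_of_all _ fun x => ?_)
    simp only [gibbsDensity_eq]
    ring
  · refine ((((i1.const_mul t).sub iU).sub (i0.const_mul (logPartition U t))).const_mul
      (exp (-logPartition U t))).congr (ae_of_all _ fun x => ?_)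
    simp only [Pi.sub_apply]
    rw [show log (gibbsDensity U t x) = t * x - U x - logPartition U t from log_exp _,
      gibbsDensity_eq]
    ring
  · refine (iU.const_mul (exp (-logPartition U t))).congr (ae_of_all _ fun x => ?_)
    simp only [gibbsDensity_eq]
    ring

lemma AdmissibleDensity1.integrable {ρ : ℝ → ℝ} (hρ : AdmissibleDensity1 U ρ) : Integrable ρ := by
  by_contra h
  have := hρ.total
  rw [integral_undef h] at this
  exact zero_ne_one this

lemma AdmissibleDensity1.integrable_mul_id {ρ : ℝ → ℝ} (hρ : AdmissibleDensity1 U ρ) :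
    Integrable fun x => ρ x * x := by
  refine (hρ.integrable.add hρ.mom2).mono' (hρ.meas.mul measurable_id).aestronglyMeasurable
    (ae_of_all _ fun x => ?_)
  rw [norm_mul, norm_of_nonneg (hρ.nonneg x), Real.norm_eq_abs, Pi.add_apply]
  have : |x| ≤ 1 + x ^ 2 :=
    abs_le.2 ⟨by nlinarith [sq_nonneg (x + 1)], by nlinarith [sq_nonneg (x - 1)]⟩
  nlinarith [hρ.nonneg x]

lemma AdmissibleDensity1.integral_energy {ρ : ℝ → ℝ} (hρ : AdmissibleDensity1 U ρ) (s : ℝ) :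
    ∫ x, ρ x * (U x - x * s) = (∫ x, ρ x * U x) - s * densMean1 ρ := by
  rw [densMean1, ← integral_const_mul,
    ← integral_sub hρ.energy (hρ.integrable_mul_id.const_mul _)]
  congr with x
  ring

/-- The Gibbs variational principle. -/
lemma AdmissibleDensity1.neg_logPartition_le (hc : Continuous U) (hU : Superquadratic U)
    {ρ : ℝ → ℝ} (hρ : AdmissibleDensity1 U ρ) (t : ℝ) :
    -logPartition U t ≤
      (∫ x, ρ x * U x) - t * densMean1 ρ + ∫ x, ρ x * log (ρ x) := by
  have hpt : ∀ x, ρ x - gibbsDensity U t x ≤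
      ρ x * log (ρ x) + ρ x * U x - t * (ρ x * x) + logPartition U t * ρ x := by
    intro x
    have hg : 0 < gibbsDensity U t x := exp_pos _
    rcases (hρ.nonneg x).eq_or_lt with h | h
    · simp [← h, hg.le]
    · have h1 := log_le_sub_one_of_pos (div_pos hg h)
      rw [log_div hg.ne' h.ne',
        show log (gibbsDensity U t x) = t * x - U x - logPartition U t from log_exp _] at h1
      have h2 := mul_le_mul_of_nonneg_left h1 h.le
      rw [mul_sub (ρ x) (gibbsDensity U t x / ρ x), mul_div_cancel₀ _ h.ne'] at h2
      nlinarith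
  have j1 := hρ.ent.add hρ.energy
  have j2 := j1.sub (hρ.integrable_mul_id.const_mul t)
  have hint := integral_mono (hρ.integrable.sub (integrable_gibbsDensity hc hU t))
    (j2.add (hρ.integrable.const_mul (logPartition U t))) hpt
  rw [integral_sub' hρ.integrable (integrable_gibbsDensity hc hU t),
    integral_add' j2 (hρ.integrable.const_mul (logPartition U t)),
    integral_sub' j1 (hρ.integrable_mul_id.const_mul t),
    integral_add' hρ.ent hρ.energy, integral_const_mul, integral_const_mul, hρ.total,
    integral_gibbsDensity hc hU] at hint
  rw [densMean1]
  linarith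

lemma integral_gibbsDensity_energy_add_entropy (hc : Continuous U) (hU : Superquadratic U)
    (t : ℝ) :
    (∫ x, gibbsDensity U t x * U x) - t * densMean1 (gibbsDensity U t) +
      ∫ x, gibbsDensity U t x * log (gibbsDensity U t x) = -logPartition U t := by
  have hρ := admissibleDensity1_gibbsDensity hc hU t
  have j : Integrable fun x => gibbsDensity U t x * U x - t * (gibbsDensity U t x * x) :=
    hρ.energy.sub (hρ.integrable_mul_id.const_mul t)
  rw [densMean1, ← integral_const_mul,
    ← integral_sub hρ.energy (hρ.integrable_mul_id.const_mul t), ← integral_add j hρ.ent]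
  calc _ = ∫ x, -logPartition U t * gibbsDensity U t x := by
        congr with x
        rw [show log (gibbsDensity U t x) = t * x - U x - logPartition U t from log_exp _]
        ring
    _ = _ := by rw [integral_const_mul, integral_gibbsDensity hc hU, mul_one]

/-- The minimal free energy is attained at a Gibbs density. -/
lemma wFun1_eq (hc : Continuous U) (hU : Superquadratic U) {h : ℝ → ℝ} {t k : ℝ}
    (hk : ∀ y, h (deriv (logPartition U) t) + k * (y - deriv (logPartition U) t) ≤ h y) (κ : ℝ) :
    wFun1 U h κ (t + k) = (t + k) ^ 2 / (2 * κ) +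
      (-logPartition U t + h (deriv (logPartition U) t) - k * deriv (logPartition U) t) := by
  rw [wFun1]
  congr 1
  refine IsLeast.csInf_eq ⟨⟨gibbsDensity U t, admissibleDensity1_gibbsDensity hc hU t, ?_⟩, ?_⟩
  · rw [freeEnergy1, (admissibleDensity1_gibbsDensity hc hU t).integral_energy,
      densMean1_gibbsDensity hc hU]
    have := integral_gibbsDensity_energy_add_entropy hc hU t
    rw [densMean1_gibbsDensity hc hU] at this
    linarith
  · rintro s ⟨ρ, hρ, rfl⟩
    rw [freeEnergy1, hρ.integral_energy]
    linarith [hρ.neg_logPartition_le hc hU t, hk (densMean1 ρ)]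

end FreeEnergy

section Regularity

variable {U h k : ℝ → ℝ}

lemma exists_homeomorph_add_comp {g : ℝ → ℝ} (hg : Monotone g) (hgc : Continuous g)
    (hk : Monotone k) (hkc : Continuous k) : ∃ T : ℝ ≃ₜ ℝ, ∀ t, T t = t + k (g t) := by
  have hmono : StrictMono fun t => t + k (g t) := strictMono_id.add_monotone (hk.comp hg)
  have hcont : Continuous fun t => t + k (g t) := by fun_prop
  have hsurj : Function.Surjective fun t => t + k (g t) := by
    refine hcont.surjective ?_ ?_
    · refine tendsto_atTop_add_right_of_le' _ (k (g 0)) tendsto_id ?_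
      filter_upwards [eventually_ge_atTop 0] with t ht using hk (hg ht)
    · refine tendsto_atBot_add_right_of_ge' _ (k (g 0)) tendsto_id ?_
      filter_upwards [eventually_le_atBot 0] with t ht using hk (hg ht)
  exact ⟨(hmono.orderIsoOfSurjective _ hsurj).toHomeomorph, fun t => rfl⟩

/-- The derivative of `wFun1` is expressed through the inverse of `t ↦ t + h' (Λ' t)`, with `Λ` the
log-partition function. -/
lemma hasDerivAt_wFun1 (hc : Continuous U) (hU : Superquadratic U)
    (hh : ∀ y, HasDerivAt h (k y) y) (hk : Monotone k) (hk1 : ContDiff ℝ 1 k) (κ : ℝ) {T : ℝ ≃ₜ ℝ}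
    (hT : ∀ t, T t = t + k (deriv (logPartition U) t)) :
    ContDiff ℝ 1 T.symm ∧
      ∀ θ, HasDerivAt (wFun1 U h κ) (θ / κ - deriv (logPartition U) (T.symm θ)) θ := by
  set Λ := logPartition U with hΛ
  have hΛ1 : ContDiff ℝ 1 (deriv Λ) :=
    ((contDiff_succ_iff_deriv (n := 1)).1 (contDiff_logPartition hc hU 2)).2.2
  have dΛ : ∀ t, HasDerivAt Λ (deriv Λ t) t := fun t =>
    ((contDiff_logPartition hc hU 1).differentiable (by simp) t).hasDerivAt
  have ddΛ : ∀ t, HasDerivAt (deriv Λ) (deriv (deriv Λ) t) t := fun t =>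
    (hΛ1.differentiable (by simp) t).hasDerivAt
  have dk : ∀ y, HasDerivAt k (deriv k y) y := fun y =>
    (hk1.differentiable (by simp) y).hasDerivAt
  have hTfun : (T : ℝ → ℝ) = fun t => t + k (deriv Λ t) := funext hT
  have dT : ∀ t, HasDerivAt T (1 + deriv k (deriv Λ t) * deriv (deriv Λ) t) t := by
    intro t
    rw [hTfun]
    exact (hasDerivAt_id t).add ((dk _).comp t (ddΛ t))
  have T'pos : ∀ t, 1 + deriv k (deriv Λ t) * deriv (deriv Λ) t ≠ 0 := by
    intro t
    have h1 : 0 ≤ deriv k (deriv Λ t) := hk.deriv_nonneg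
    have := mul_nonneg h1 (deriv_deriv_logPartition_nonneg hc hU t)
    positivity
  have hTs : ContDiff ℝ 1 T.symm := T.contDiff_symm_deriv T'pos dT (by
    rw [hTfun]
    exact contDiff_id.add (hk1.comp hΛ1))
  have hconv : ConvexOn ℝ univ h := by
    refine Monotone.convexOn_univ_of_deriv (fun y => (hh y).differentiableAt) ?_
    rwa [show deriv h = k from funext fun y => (hh y).deriv]
  have htan : ∀ m y, h m + k m * (y - m) ≤ h y := fun m y =>
    (hh m).deriv ▸ hconv.add_deriv_mul_sub_le (hh m).differentiableAt y
  have hw : wFun1 U h κ = fun θ => θ ^ 2 / (2 * κ) + (fun t =>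
      -Λ t + h (deriv Λ t) - k (deriv Λ t) * deriv Λ t) (T.symm θ) := by
    ext θ
    have := wFun1_eq hc hU (htan (deriv Λ (T.symm θ))) κ
    rwa [← hΛ, ← hT, T.apply_symm_apply] at this
  refine ⟨hTs, fun θ => ?_⟩
  have dS : HasDerivAt T.symm (deriv T.symm θ) θ :=
    (hTs.differentiable (by simp) θ).hasDerivAt
  have hS : (1 + deriv k (deriv Λ (T.symm θ)) * deriv (deriv Λ) (T.symm θ)) *
      deriv T.symm θ = 1 := by
    have h1 := (dT (T.symm θ)).comp θ dS
    have h2 : (T ∘ T.symm : ℝ → ℝ) = id := by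
      ext x
      simp
    rw [h2] at h1
    exact h1.unique (hasDerivAt_id θ)
  have dB := (((dΛ (T.symm θ)).neg.add ((hh _).comp _ (ddΛ (T.symm θ)))).sub
    (((dk _).comp _ (ddΛ (T.symm θ))).mul (ddΛ (T.symm θ)))).comp θ dS
  have dq : HasDerivAt (fun θ : ℝ => θ ^ 2 / (2 * κ)) (θ / κ) θ := by
    refine ((hasDerivAt_pow 2 θ).div_const (2 * κ)).congr_deriv ?_
    simp only [Nat.cast_ofNat, Nat.add_one_sub_one, pow_one]
    exact mul_div_mul_left _ _ two_ne_zero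
  rw [hw]
  refine (dq.add dB).congr_deriv ?_
  simp only [Function.comp_apply]
  linear_combination (-deriv Λ (T.symm θ)) * hS

end Regularity

section Ramp

/-- A bounded nondecreasing `C¹` function vanishing exactly on `(-∞, 0]`. -/
def ramp (s : ℝ) : ℝ := max s 0 ^ 2 / (1 + max s 0 ^ 2)

lemma ramp_of_nonpos {s : ℝ} (hs : s ≤ 0) : ramp s = 0 := by
  simp [ramp, max_eq_right hs]

lemma ramp_nonneg (s : ℝ) : 0 ≤ ramp s := by
  unfold ramp
  positivity

lemma ramp_pos {s : ℝ} (hs : 0 < s) : 0 < ramp s := by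
  rw [ramp, max_eq_left hs.le]
  positivity

lemma ramp_le_one (s : ℝ) : ramp s ≤ 1 := by
  rw [ramp, div_le_one (by positivity)]
  linarith

lemma hasDerivAt_max_zero_sq (s : ℝ) :
    HasDerivAt (fun s : ℝ => max s 0 ^ 2) (2 * max s 0) s := by
  rcases lt_trichotomy s 0 with h | h | h
  · rw [max_eq_right h.le, mul_zero]
    refine (hasDerivAt_const s (0 : ℝ)).congr_of_eventuallyEq ?_
    filter_upwards [eventually_lt_nhds h] with y hy
    simp [max_eq_right hy.le]
  · subst h
    rw [max_self, mul_zero]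
    have h : Tendsto (fun y : ℝ => max y 0) (nhdsWithin 0 {0}ᶜ) (nhds 0) := by
      have : Continuous fun y : ℝ => max y 0 := by fun_prop
      simpa using (this.tendsto 0).mono_left nhdsWithin_le_nhds
    refine hasDerivAt_iff_tendsto_slope.2 (h.congr fun y => ?_)
    rw [slope_def_field]
    rcases le_or_gt y 0 with hy | hy
    · simp [max_eq_right hy]
    · simp only [max_eq_left hy.le, max_self]
      field_simp
      ring
  · rw [max_eq_left h.le]
    refine HasDerivAt.congr_of_eventuallyEq (f := fun y : ℝ => y ^ 2)
      (by simpa using hasDerivAt_pow 2 s) ?_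
    filter_upwards [eventually_gt_nhds h] with y hy
    simp [max_eq_left hy.le]

lemma hasDerivAt_ramp (s : ℝ) :
    HasDerivAt ramp (2 * max s 0 / (1 + max s 0 ^ 2) ^ 2) s := by
  have h := hasDerivAt_max_zero_sq s
  refine (h.div (h.const_add 1) (by positivity)).congr_deriv ?_
  ring

lemma deriv_ramp : deriv ramp = fun s => 2 * max s 0 / (1 + max s 0 ^ 2) ^ 2 :=
  funext fun s => (hasDerivAt_ramp s).deriv

lemma differentiable_ramp : Differentiable ℝ ramp := fun s => (hasDerivAt_ramp s).differentiableAt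

lemma contDiff_ramp : ContDiff ℝ 1 ramp := by
  refine contDiff_one_iff_deriv.2 ⟨differentiable_ramp, ?_⟩
  rw [deriv_ramp]
  exact Continuous.div (by fun_prop) (by fun_prop) fun s => by positivity

lemma deriv_ramp_nonneg (s : ℝ) : 0 ≤ deriv ramp s := by
  rw [deriv_ramp]
  positivity

lemma deriv_ramp_le_one (s : ℝ) : deriv ramp s ≤ 1 := by
  rw [deriv_ramp, div_le_one (by positivity)]
  nlinarith [sq_nonneg (max s 0 - 1), sq_nonneg (max s 0 ^ 2)]

lemma monotone_ramp : Monotone ramp :=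
  monotone_of_deriv_nonneg differentiable_ramp deriv_ramp_nonneg

/-- The primitive of `ramp` vanishing on `(-∞, 0]`. -/
def rampPrimitive (s : ℝ) : ℝ := ∫ y in (0 : ℝ)..s, ramp y

lemma hasDerivAt_rampPrimitive (s : ℝ) : HasDerivAt rampPrimitive (ramp s) s :=
  (contDiff_ramp.continuous.integral_hasStrictDerivAt 0 s).hasDerivAt

lemma rampPrimitive_of_nonpos {s : ℝ} (hs : s ≤ 0) : rampPrimitive s = 0 := by
  rw [rampPrimitive, intervalIntegral.integral_congr (g := fun _ => (0 : ℝ))]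
  · simp
  · intro y hy
    rw [uIcc_of_ge hs] at hy
    exact ramp_of_nonpos hy.2

end Ramp

section Coercivity

lemma exists_mul_sub_le_of_pos {φ : ℝ → ℝ} (hφ : Continuous φ) {m ε c C : ℝ} (hε : 0 < ε)
    (hc : 0 < c) (hpos : ∀ u, m < u → 0 < φ u)
    (hnear : ∀ u, m ≤ u → u ≤ m + ε → c * (u - m) ≤ φ u) (hfar : ∀ u, m ≤ u → u / 2 - C ≤ φ u) :
    ∃ η, 0 < η ∧ ∀ u, m ≤ u → η * (u - m) ≤ φ u := by
  set R := max (m + ε) (4 * C - m) with hR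
  have hR1 : m + ε ≤ R := le_max_left _ _
  have hR2 : 4 * C - m ≤ R := le_max_right _ _
  obtain ⟨x, hx, hmin⟩ := isCompact_Icc.exists_isMinOn (nonempty_Icc.2 hR1) hφ.continuousOn
  have hp : 0 < φ x := hpos x (by linarith [hx.1])
  have hRm : 0 < R - m := by linarith
  refine ⟨min (min c (1 / 4)) (φ x / (R - m)), by positivity, fun u hu => ?_⟩
  have hum : 0 ≤ u - m := by linarith
  rcases le_total u (m + ε) with h1 | h1
  · exact (mul_le_mul_of_nonneg_right ((min_le_left _ _).trans (min_le_left _ _)) hum).trans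
      (hnear u hu h1)
  rcases le_total u R with h2 | h2
  · calc _ ≤ φ x / (R - m) * (u - m) := mul_le_mul_of_nonneg_right (min_le_right _ _) hum
      _ ≤ φ x / (R - m) * (R - m) := by gcongr
      _ = φ x := div_mul_cancel₀ _ hRm.ne'
      _ ≤ φ u := hmin ⟨h1, h2⟩
  · refine (mul_le_mul_of_nonneg_right
      ((min_le_left _ _).trans (min_le_right _ _)) hum).trans (le_trans ?_ (hfar u hu))
    linarith

/-- Adding a multiple of a ramp, inactive on `D`, makes `u ↦ u - f u` coercive to the right of the
only fixed point of `f` in `D`. -/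
lemma exists_ramp_coercive {f : ℝ → ℝ} (hf : Monotone f) (hfc : Continuous f) {m l s C : ℝ}
    (hs : 0 < s) (hfm : f m = m) (hfd : HasDerivAt f l m) (hl : l < 1)
    (hgrow : ∀ u, u * f u ≤ u ^ 2 / 2 + C) {D : Set ℝ} (hDclosed : IsClosed D)
    (hDint : D.OrdConnected) (hmD : m ∈ D) (huniq : ∀ u ∈ D, f u = u → u = m) :
    ∃ A b, 0 ≤ A ∧ m < b ∧ (∀ y ∈ D, A = 0 ∨ y ≤ b) ∧
      ∃ η, 0 < η ∧ ∀ u, m ≤ u → η * (u - m) ≤ u - f u + s * (A * ramp (f u - b)) := by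
  obtain ⟨ε, hε, hnear⟩ : ∃ ε, 0 < ε ∧
      ∀ u, m ≤ u → u ≤ m + ε → (1 - l) / 2 * (u - m) ≤ u - f u := by
    have h1 := (hasDerivAt_iff_tendsto_slope.1 hfd).eventually_lt_const
      (show l < (1 + l) / 2 by linarith)
    rw [eventually_nhdsWithin_iff, Metric.eventually_nhds_iff] at h1
    obtain ⟨ε, hε, h⟩ := h1
    refine ⟨ε / 2, by positivity, fun u hu hu' => ?_⟩
    rcases hu.eq_or_lt with rfl | hlt
    · simp [hfm]
    · have h2 := h (y := u) (by rw [Real.dist_eq, abs_of_pos (by linarith)]; linarith) hlt.ne'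
      rw [slope_def_field, div_lt_iff₀ (by linarith), hfm] at h2
      linarith
  have hnear' : ∀ u, m < u → u ≤ m + ε → f u < u := fun u hu hu' => by
    have : 0 < (1 - l) / 2 * (u - m) := mul_pos (by linarith) (by linarith)
    linarith [hnear u hu.le hu']
  have hD : ∀ u ∈ D, m < u → f u < u := by
    intro u hu hmu
    by_contra! hle
    rcases le_or_gt u (m + ε) with h1 | h1
    · exact (hnear' u hmu h1).not_ge hle
    · have h2 := hnear' (m + ε) (by linarith) le_rfl
      obtain ⟨v, hv, hv0⟩ := intermediate_value_Icc h1.le (f := fun v => f v - v)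
        (by fun_prop) (show (0 : ℝ) ∈ Icc _ _ from ⟨by linarith, by linarith⟩)
      have hvm := huniq v (hDint.out hmD hu ⟨by linarith [hv.1], hv.2⟩) (by linarith)
      linarith [hv.1]
  set C' := |C| + |f 1| + |m| / 2 with hC'
  have hlin : ∀ u, m ≤ u → f u ≤ u / 2 + C' := by
    intro u hu
    rcases le_total 1 u with h | h
    · have h1 : u * f u ≤ u * (u / 2 + |C|) := by nlinarith [hgrow u, le_abs_self C, abs_nonneg C]
      have h2 := le_of_mul_le_mul_left h1 (by linarith)
      linarith [abs_nonneg (f 1), abs_nonneg m]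
    · linarith [hf h, le_abs_self (f 1), abs_nonneg C, neg_abs_le m]
  have finish : ∀ A b, 0 ≤ A → (∀ u, m < u → 0 < u - f u + s * (A * ramp (f u - b))) →
      ∃ η, 0 < η ∧ ∀ u, m ≤ u → η * (u - m) ≤ u - f u + s * (A * ramp (f u - b)) := by
    intro A b hA hpos
    have hr : ∀ u, 0 ≤ s * (A * ramp (f u - b)) := fun u =>
      mul_nonneg hs.le (mul_nonneg hA (ramp_nonneg _))
    have hrc := contDiff_ramp.continuous
    exact exists_mul_sub_le_of_pos (C := C') (by fun_prop) hε
      (show 0 < (1 - l) / 2 by linarith) hpos (fun u hu hu' => by linarith [hnear u hu hu', hr u])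
      (fun u hu => by linarith [hlin u hu, hr u])
  by_cases hbdd : BddAbove D
  · have hb0 := hDclosed.csSup_mem ⟨m, hmD⟩ hbdd
    set b := max (sSup D) (m + ε) with hb
    have hmb : m < b := lt_max_of_lt_right (by linarith)
    have hlt : ∀ u, m < u → u ≤ b → f u < u := by
      intro u hu hub
      rcases le_max_iff.1 hub with h | h
      · exact hD u (hDint.out hmD hb0 ⟨hu.le, h⟩) hu
      · exact hnear' u hu h
    obtain ⟨δ, hδ, hfδ⟩ : ∃ δ, 0 < δ ∧ f (b + δ) < b := by
      have := hfc.continuousAt.eventually_lt_const (hlt b hmb le_rfl)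
      obtain ⟨δ, hδ, h⟩ := Metric.eventually_nhds_iff.1 this
      exact ⟨δ / 2, by positivity, h (by
        rw [Real.dist_eq, add_sub_cancel_left, abs_of_pos (by positivity)]
        linarith)⟩
    set K := C' - m / 2 with hK
    have hr := ramp_pos (half_pos hδ)
    have hA : 0 ≤ (|K| + 1) / (s * ramp (δ / 2)) := by positivity
    refine ⟨(|K| + 1) / (s * ramp (δ / 2)), b, hA, hmb,
      fun y hy => Or.inr ((le_csSup hbdd hy).trans (le_max_left _ _)), finish _ _ hA ?_⟩
    intro u hu
    have hr0 : 0 ≤ s * ((|K| + 1) / (s * ramp (δ / 2)) * ramp (f u - b)) :=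
      mul_nonneg hs.le (mul_nonneg hA (ramp_nonneg _))
    rcases le_or_gt u b with h1 | h1
    · linarith [hlt u hu h1]
    rcases le_or_gt (f u) b with h2 | h2
    · linarith
    have h3 : b + δ < u := by
      by_contra! h
      linarith [hf h]
    rcases le_or_gt (f u) (b + δ / 2) with h4 | h4
    · linarith
    have h5 : |K| + 1 ≤ s * ((|K| + 1) / (s * ramp (δ / 2)) * ramp (f u - b)) := by
      calc |K| + 1 = s * ((|K| + 1) / (s * ramp (δ / 2)) * ramp (δ / 2)) := by field_simp
        _ ≤ _ := by
          gcongr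
          exact monotone_ramp (by linarith)
    linarith [hlin u hu.le, le_abs_self K]
  · refine ⟨0, m + 1, le_rfl, by linarith, fun y _ => Or.inl rfl, finish _ _ le_rfl ?_⟩
    intro u hu
    obtain ⟨v, hv, huv⟩ := not_bddAbove_iff.1 hbdd u
    have := hD u (hDint.out hmD hv ⟨hu.le, huv.le⟩) hu
    simpa using this

end Coercivity

section Potential

lemma superquadratic_of_rpow_le_mul_deriv {V : ℝ → ℝ} (hV : Differentiable ℝ V) {β R : ℝ}
    (hβ : 2 < β) (hgrow : ∀ x : ℝ, R ≤ |x| → |x| ^ β ≤ x * deriv V x) : Superquadratic V := by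
  intro N hN
  obtain ⟨R₁, hR₁⟩ := eventually_atTop.1
    ((tendsto_rpow_atTop (show 0 < β - 2 by linarith)).eventually_ge_atTop (2 * N))
  set R₀ := max (max R R₁) 1 with hR₀
  have hR₀1 : 1 ≤ R₀ := le_max_right _ _
  set q : ℝ → ℝ := fun x => V x - N * x ^ 2 with hq
  have dq : ∀ x, HasDerivAt q (deriv V x - N * (2 * x)) x := fun x =>
    (hV x).hasDerivAt.sub (by simpa using (hasDerivAt_pow 2 x).const_mul N)
  have hqc : Continuous q := continuous_iff_continuousAt.2 fun x => (dq x).continuousAt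
  have hsign : ∀ x, R₀ ≤ |x| → 0 ≤ x * (deriv V x - N * (2 * x)) := by
    intro x hx
    have hx0 : 0 < |x| := by linarith
    have h1 := hgrow x (((le_max_left _ _).trans (le_max_left _ _)).trans hx)
    have h2 := hR₁ |x| (((le_max_right _ _).trans (le_max_left _ _)).trans hx)
    have h3 : |x| ^ β = |x| ^ (β - 2) * x ^ 2 := by
      rw [← sq_abs x, ← rpow_two, ← rpow_add hx0, sub_add_cancel]
    nlinarith [sq_nonneg x]
  have hright : MonotoneOn q (Ici R₀) := by
    refine monotoneOn_of_deriv_nonneg (convex_Ici _) hqc.continuousOn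
      (fun x _ => (dq x).differentiableAt.differentiableWithinAt) fun x hx => ?_
    rw [interior_Ici, mem_Ioi] at hx
    rw [(dq x).deriv]
    exact nonneg_of_mul_nonneg_right (hsign x (hx.le.trans (le_abs_self x))) (by linarith)
  have hleft : AntitoneOn q (Iic (-R₀)) := by
    refine antitoneOn_of_deriv_nonpos (convex_Iic _) hqc.continuousOn
      (fun x _ => (dq x).differentiableAt.differentiableWithinAt) fun x hx => ?_
    rw [interior_Iic, mem_Iio] at hx
    rw [(dq x).deriv]
    have := hsign x (by linarith [neg_le_abs x])
    by_contra! h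
    nlinarith
  obtain ⟨z, -, hz⟩ := isCompact_Icc.exists_isMinOn
    (nonempty_Icc.2 (show -R₀ ≤ R₀ by linarith)) hqc.continuousOn
  have hmin : ∀ x, q z ≤ q x := by
    intro x
    rcases le_total x (-R₀) with h | h
    · exact (hz ⟨le_rfl, by linarith⟩ : q z ≤ q (-R₀)).trans (hleft h self_mem_Iic h)
    rcases le_total x R₀ with h' | h'
    · exact hz ⟨h, h'⟩
    · exact (hz ⟨by linarith, le_rfl⟩ : q z ≤ q R₀).trans (hright self_mem_Ici h' h')
  refine ⟨-q z, fun x => ?_⟩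
  have := hmin x
  simp only [hq] at this ⊢
  linarith

lemma fFun_eq_deriv_logPartition {σ κ : ℝ} {V U : ℝ → ℝ} (hκ : κ = 1 / σ ^ 2)
    (hUV : ∀ x, U x = (V x + x ^ 2 / 2) / σ ^ 2) (hc : Continuous U) (hU : Superquadratic U)
    (m : ℝ) : fFun σ V m = deriv (logPartition U) (κ * m) := by
  have h : ∀ x, nuDens σ V m x = exp (-(κ * m ^ 2 / 2)) * exp (κ * m * x - U x) := by
    intro x
    rw [nuDens, ← exp_add, hUV, hκ]
    ring_nf
  have h1 : ∫ x, x * nuDens σ V m x =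
      exp (-(κ * m ^ 2 / 2)) * ∫ x, x * exp (κ * m * x - U x) := by
    rw [← integral_const_mul]
    congr with x
    rw [h]
    ring
  have h2 : ∫ x, nuDens σ V m x = exp (-(κ * m ^ 2 / 2)) * ∫ x, exp (κ * m * x - U x) := by
    rw [← integral_const_mul]
    simp only [h]
  rw [fFun, h1, h2, mul_div_mul_left _ _ (exp_pos _).ne', deriv_logPartition hc hU]

end Potential

section TwoSidedRamp

variable (A₁ b₁ A₂ b₂ : ℝ)

/-- A weighted sum of two opposite ramp primitives, vanishing on `[-b₂, b₁]`. -/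
def twoRampPrimitive (y : ℝ) : ℝ := A₁ * rampPrimitive (y - b₁) + A₂ * rampPrimitive (-y - b₂)

/-- The derivative of `twoRampPrimitive`. -/
def twoRamp (y : ℝ) : ℝ := A₁ * ramp (y - b₁) - A₂ * ramp (-y - b₂)

lemma hasDerivAt_twoRampPrimitive (y : ℝ) :
    HasDerivAt (twoRampPrimitive A₁ b₁ A₂ b₂) (twoRamp A₁ b₁ A₂ b₂ y) y := by
  have h1 := ((hasDerivAt_rampPrimitive (y - b₁)).comp y
    ((hasDerivAt_id y).sub_const b₁)).const_mul A₁
  have h2 := ((hasDerivAt_rampPrimitive (-y - b₂)).comp y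
    ((hasDerivAt_id y).neg.sub_const b₂)).const_mul A₂
  refine (h1.add h2).congr_deriv ?_
  rw [twoRamp]
  ring

lemma contDiff_twoRamp : ContDiff ℝ 1 (twoRamp A₁ b₁ A₂ b₂) := by
  have := contDiff_ramp
  unfold twoRamp
  fun_prop

lemma deriv_twoRamp (y : ℝ) : deriv (twoRamp A₁ b₁ A₂ b₂) y =
    A₁ * deriv ramp (y - b₁) + A₂ * deriv ramp (-y - b₂) := by
  have h1 := ((differentiable_ramp (y - b₁)).hasDerivAt.comp y
    ((hasDerivAt_id y).sub_const b₁)).const_mul A₁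
  have h2 := ((differentiable_ramp (-y - b₂)).hasDerivAt.comp y
    ((hasDerivAt_id y).neg.sub_const b₂)).const_mul A₂
  refine ((h1.sub h2).congr_deriv ?_).deriv
  ring

variable {A₁ A₂}

lemma deriv_twoRamp_nonneg (h₁ : 0 ≤ A₁) (h₂ : 0 ≤ A₂) (y : ℝ) :
    0 ≤ deriv (twoRamp A₁ b₁ A₂ b₂) y := by
  rw [deriv_twoRamp]
  have := deriv_ramp_nonneg (y - b₁)
  have := deriv_ramp_nonneg (-y - b₂)
  positivity

lemma deriv_twoRamp_le (h₁ : 0 ≤ A₁) (h₂ : 0 ≤ A₂) (y : ℝ) :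
    deriv (twoRamp A₁ b₁ A₂ b₂) y ≤ A₁ + A₂ := by
  rw [deriv_twoRamp]
  nlinarith [deriv_ramp_le_one (y - b₁), deriv_ramp_le_one (-y - b₂)]

lemma monotone_twoRamp (h₁ : 0 ≤ A₁) (h₂ : 0 ≤ A₂) : Monotone (twoRamp A₁ b₁ A₂ b₂) :=
  monotone_of_deriv_nonneg ((contDiff_twoRamp A₁ b₁ A₂ b₂).differentiable (by simp))
    (deriv_twoRamp_nonneg b₁ b₂ h₁ h₂)

lemma abs_twoRamp_le (h₁ : 0 ≤ A₁) (h₂ : 0 ≤ A₂) (y : ℝ) :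
    |twoRamp A₁ b₁ A₂ b₂ y| ≤ A₁ + A₂ := by
  have i1 := mul_nonneg h₁ (ramp_nonneg (y - b₁))
  have i2 := mul_nonneg h₂ (ramp_nonneg (-y - b₂))
  have i3 := mul_le_of_le_one_right h₁ (ramp_le_one (y - b₁))
  have i4 := mul_le_of_le_one_right h₂ (ramp_le_one (-y - b₂))
  rw [twoRamp]
  exact abs_le.2 ⟨by linarith, by linarith⟩

end TwoSidedRamp

lemma sub_le_mul_sub_of_deriv_le {f : ℝ → ℝ} (hf : Differentiable ℝ f) {C : ℝ}
    (hC : ∀ x, deriv f x ≤ C) {x y : ℝ} (hxy : x ≤ y) : f y - f x ≤ C * (y - x) :=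
  Convex.image_sub_le_mul_sub_of_deriv_le convex_univ hf.continuous.continuousOn
    hf.differentiableOn (fun z _ => hC z) x (mem_univ x) y (mem_univ y) hxy

/-- **Proposition (existence of the modified energy, dimension 1).** There exists a convex
`C²` function `h` with bounded first and second derivatives, vanishing on `D`, such that
`w_h` is `C²`, has Hessian bounded below, and satisfies the coercivity condition of
Assumption LSIN2. -/
theorem exists_modified_h_dim1
    (σ : ℝ) (hσ : 0 < σ)
    -- confining potential V
    (V Vc Vb : ℝ → ℝ) (hV : ContDiff ℝ 2 V) (hdec : ∀ x, V x = Vc x + Vb x)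
    (ρ₀ : ℝ) (hρ₀ : 0 < ρ₀) (hVc : StrongConvexOn Set.univ ρ₀ Vc)
    (Mb : ℝ) (hVb : ∀ x, |Vb x| ≤ Mb)
    (β R_V θ₀ : ℝ) (hβ : 2 < β) (hRV : 0 < R_V) (hθ₀ : 0 < θ₀)
    (hgrow : ∀ x : ℝ, R_V ≤ |x| → x * deriv V x ≥ |x| ^ β ∧ |deriv V x| ≤ |x| ^ θ₀)
    (L : ℝ) (hL : 0 < L)
    (hOS : ∀ x y : ℝ, (deriv V x - deriv V y) * (x - y) ≥ -L * (x - y) ^ 2)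
    -- κ and the effective single-particle potential
    (κ : ℝ) (hκ : κ = 1 / σ ^ 2)
    (V₀ : ℝ → ℝ) (hV₀ : ∀ x, V₀ x = (V x + x ^ 2 / 2) / σ ^ 2)
    -- attractor and metastable domain
    (mstar : ℝ) (hfixstar : fFun σ V mstar = mstar)
    (hf' : |deriv (fFun σ V) mstar| < 1)
    (D : Set ℝ) (hDne : D ≠ Set.univ) (hDclosed : IsClosed D)
    (hDinterval : D.OrdConnected) (hmemD : mstar ∈ D)
    (huniq : ∀ m ∈ D, fFun σ V m = m → m = mstar) :
    ∃ h : ℝ → ℝ, ContDiff ℝ 2 h ∧ ConvexOn ℝ Set.univ h ∧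
      (∃ M : ℝ, ∀ y, |deriv h y| ≤ M) ∧
      (∃ M : ℝ, ∀ y, |iteratedDeriv 2 h y| ≤ M) ∧
      (∀ m ∈ D, h m = 0) ∧
      ContDiff ℝ 2 (wFun1 V₀ h κ) ∧
      (∃ K : ℝ, ConvexOn ℝ Set.univ (fun θ => wFun1 V₀ h κ θ - K / 2 * θ ^ 2)) ∧
      (∃ θs η : ℝ, 0 < η ∧ ∀ θ : ℝ,
        (θ - θs) * deriv (wFun1 V₀ h κ) θ ≥ η * (θ - θs) ^ 2) := by
  have hσ2 : 0 < σ ^ 2 := by positivity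
  have hκ0 : 0 < κ := by
    rw [hκ]
    positivity
  have hVd : Differentiable ℝ V := hV.differentiable (by simp)
  have hUc : Continuous V₀ := by
    rw [funext hV₀]
    have := hV.continuous
    fun_prop
  have hUs : Superquadratic V₀ := by
    intro N hN
    obtain ⟨C, hC⟩ := superquadratic_of_rpow_le_mul_deriv hVd hβ (fun x hx => (hgrow x hx).1)
      (N * σ ^ 2) (by positivity)
    refine ⟨C / σ ^ 2, fun x => ?_⟩
    rw [hV₀, le_div_iff₀ hσ2, sub_mul, div_mul_cancel₀ _ hσ2.ne']
    nlinarith [hC x, sq_nonneg x]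
  set g := deriv (logPartition V₀) with hg
  have hfg : ∀ m, fFun σ V m = g (κ * m) := fFun_eq_deriv_logPartition hκ hV₀ hUc hUs
  have hg1 : ContDiff ℝ 1 g :=
    ((contDiff_succ_iff_deriv (n := 1)).1 (contDiff_logPartition hUc hUs 2)).2.2
  have hgd : Differentiable ℝ g := hg1.differentiable (by simp)
  have hgm : Monotone g := monotone_of_deriv_nonneg hgd (deriv_deriv_logPartition_nonneg hUc hUs)
  obtain ⟨C, hC⟩ : ∃ C, ∀ t, deriv g t ≤ C := by
    refine exists_deriv_deriv_logPartition_le hUc hUs (W := fun x => κ * (Vc x + x ^ 2 / 2))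
      (r := κ * ρ₀) (B := κ * Mb) (by positivity) ?_ fun x => ?_
    · have h1 : ConvexOn ℝ univ fun x : ℝ => κ / 2 * x ^ 2 :=
        (even_two.convexOn_pow (𝕜 := ℝ)).smul (by positivity)
      refine strongConvexOn_iff_convex.2
        ((((strongConvexOn_iff_convex.1 hVc).smul hκ0.le).add h1).congr fun x _ => ?_)
      simp only [Pi.add_apply, smul_eq_mul]
      simp only [Real.norm_eq_abs, sq_abs]
      ring
    · have : V₀ x - κ * (Vc x + x ^ 2 / 2) = κ * Vb x := by
        rw [hV₀, hdec, hκ]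
        ring
      rw [this, abs_mul, abs_of_pos hκ0]
      exact mul_le_mul_of_nonneg_left (hVb x) hκ0.le
  have hC0 : 0 ≤ C := (deriv_deriv_logPartition_nonneg hUc hUs 0).trans (hC 0)
  obtain ⟨C', hC'⟩ : ∃ C', ∀ u, u * fFun σ V u ≤ u ^ 2 / 2 + C' := by
    obtain ⟨C', h⟩ := mul_deriv_logPartition_le hUc hUs (ε := 1 / (2 * κ)) (by positivity)
    refine ⟨C' / κ, fun u => ?_⟩
    have h1 : κ * u * g (κ * u) / κ ≤ (1 / (2 * κ) * (κ * u) ^ 2 + C') / κ :=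
      div_le_div_of_nonneg_right (h (κ * u)) hκ0.le
    rw [hfg]
    refine le_trans (le_of_eq ?_) (h1.trans (le_of_eq ?_))
    · field_simp
    · field_simp
  have hfm : Monotone (fFun σ V) := fun a b hab => by
    rw [hfg, hfg]
    exact hgm (mul_le_mul_of_nonneg_left hab hκ0.le)
  have hfd : Differentiable ℝ (fFun σ V) := by
    rw [funext hfg]
    fun_prop
  have hl := (abs_lt.1 hf').2
  obtain ⟨A₁, b₁, hA₁, hb₁, hDb₁, η₁, hη₁, hcoer₁⟩ := exists_ramp_coercive hfm hfd.continuous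
    (one_div_pos.2 hκ0) hfixstar (hfd mstar).hasDerivAt hl hC' hDclosed hDinterval hmemD huniq
  obtain ⟨A₂, b₂, hA₂, hb₂, hDb₂, η₂, hη₂, hcoer₂⟩ := exists_ramp_coercive
    (f := fun u => -fFun σ V (-u)) (m := -mstar) (l := deriv (fFun σ V) mstar) (C := C')
    (D := (fun x => -x) ⁻¹' D)
    (fun a b hab => neg_le_neg (hfm (neg_le_neg hab))) (by have := hfd.continuous; fun_prop)
    (one_div_pos.2 hκ0) (by simp [hfixstar])
    (by
      have h1 := (hfd mstar).hasDerivAt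
      rw [← neg_neg mstar] at h1
      refine ((h1.comp (-mstar) (hasDerivAt_neg (-mstar))).neg).congr_deriv ?_
      simp)
    hl (fun u => by linarith [hC' (-u), neg_sq u]) (hDclosed.preimage continuous_neg)
    (by
      refine ⟨fun x hx y hy z hz => ?_⟩
      exact hDinterval.out hy hx ⟨neg_le_neg hz.2, neg_le_neg hz.1⟩)
    (by simpa using hmemD)
    (fun u hu h => by linarith [huniq (-u) hu (by linarith)])
  set k := twoRamp A₁ b₁ A₂ b₂ with hk
  have dh := hasDerivAt_twoRampPrimitive A₁ b₁ A₂ b₂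
  have dh' : deriv (twoRampPrimitive A₁ b₁ A₂ b₂) = k := funext fun y => (dh y).deriv
  have hkm : Monotone k := monotone_twoRamp b₁ b₂ hA₁ hA₂
  have hk1 : ContDiff ℝ 1 k := contDiff_twoRamp A₁ b₁ A₂ b₂
  obtain ⟨T, hT⟩ := exists_homeomorph_add_comp hgm hgd.continuous hkm hk1.continuous
  obtain ⟨hS1, dw⟩ := hasDerivAt_wFun1 hUc hUs dh hkm hk1 κ hT
  have dw' : deriv (wFun1 V₀ (twoRampPrimitive A₁ b₁ A₂ b₂) κ) =
      fun θ => θ / κ - g (T.symm θ) := funext fun θ => (dw θ).deriv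
  refine ⟨twoRampPrimitive A₁ b₁ A₂ b₂, ?_, ?_, ⟨A₁ + A₂, ?_⟩, ⟨A₁ + A₂, ?_⟩, ?_, ?_, ?_, ?_⟩
  · refine (contDiff_succ_iff_deriv (n := 1)).2 ⟨fun y => (dh y).differentiableAt, by simp, ?_⟩
    rwa [dh']
  · exact Monotone.convexOn_univ_of_deriv (fun y => (dh y).differentiableAt) (by rwa [dh'])
  · rw [dh']
    exact abs_twoRamp_le b₁ b₂ hA₁ hA₂
  · intro y
    rw [iteratedDeriv_succ, iteratedDeriv_one, dh',
      abs_of_nonneg (deriv_twoRamp_nonneg b₁ b₂ hA₁ hA₂ y)]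
    exact deriv_twoRamp_le b₁ b₂ hA₁ hA₂ y
  · intro y hy
    have h1 : A₁ * rampPrimitive (y - b₁) = 0 := by
      rcases hDb₁ y hy with h | h
      · simp [h]
      · rw [rampPrimitive_of_nonpos (by linarith), mul_zero]
    have h2 : A₂ * rampPrimitive (-y - b₂) = 0 := by
      rcases hDb₂ (-y) (by simpa using hy) with h | h
      · simp [h]
      · rw [rampPrimitive_of_nonpos (by linarith), mul_zero]
    rw [twoRampPrimitive, h1, h2, add_zero]
  · refine (contDiff_succ_iff_deriv (n := 1)).2 ⟨fun θ => (dw θ).differentiableAt, by simp, ?_⟩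
    rw [dw']
    exact (contDiff_id.div_const κ).sub (hg1.comp hS1)
  · refine ⟨1 / κ - C, ?_⟩
    have dW : ∀ θ, HasDerivAt (fun θ => wFun1 V₀ (twoRampPrimitive A₁ b₁ A₂ b₂) κ θ -
        (1 / κ - C) / 2 * θ ^ 2) (C * θ - g (T.symm θ)) θ := by
      intro θ
      refine ((dw θ).sub ((hasDerivAt_pow 2 θ).const_mul ((1 / κ - C) / 2))).congr_deriv ?_
      simp only [Nat.cast_ofNat, Nat.add_one_sub_one, pow_one]
      ring
    refine Monotone.convexOn_univ_of_deriv (fun θ => (dW θ).differentiableAt) ?_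
    rw [show deriv _ = _ from funext fun θ => (dW θ).deriv]
    intro x y hxy
    have hTm : ∀ a b, a ≤ b → b - a ≤ T b - T a := fun a b hab => by
      rw [hT, hT]
      linarith [hkm (hgm hab)]
    have hS : T.symm x ≤ T.symm y := by
      by_contra! h
      have := hTm _ _ h.le
      rw [T.apply_symm_apply, T.apply_symm_apply] at this
      linarith
    have h1 := hTm _ _ hS
    rw [T.apply_symm_apply, T.apply_symm_apply] at h1
    have h2 := sub_le_mul_sub_of_deriv_le hgd hC hS
    simp only
    nlinarith
  · have hkstar : k mstar = 0 := by
      rw [hk, twoRamp, ramp_of_nonpos (by linarith), ramp_of_nonpos (by linarith)]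
      simp
    set Q := κ + (A₁ + A₂) * (C * κ) with hQ
    have hQ0 : 0 < Q := by positivity
    have hTle : ∀ a b, a ≤ b → T (κ * b) - T (κ * a) ≤ Q * (b - a) := by
      intro a b hab
      have hab' : κ * a ≤ κ * b := mul_le_mul_of_nonneg_left hab hκ0.le
      have h1 := sub_le_mul_sub_of_deriv_le hgd hC hab'
      have h2 := sub_le_mul_sub_of_deriv_le (hk1.differentiable (by simp))
        (deriv_twoRamp_le b₁ b₂ hA₁ hA₂) (hgm hab')
      have h3 := mul_le_mul_of_nonneg_left h1 (add_nonneg hA₁ hA₂)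
      rw [hT, hT, hQ]
      linarith
    have hTm : ∀ a b, a ≤ b → T (κ * a) ≤ T (κ * b) := by
      intro a b hab
      have hab' : κ * a ≤ κ * b := mul_le_mul_of_nonneg_left hab hκ0.le
      rw [hT, hT]
      linarith [hkm (hgm hab')]
    have hTstar : T (κ * mstar) = κ * mstar := by
      rw [hT, ← hfg, hfixstar, hkstar, add_zero]
    refine ⟨κ * mstar, min η₁ η₂ / Q, by positivity, fun θ => ?_⟩
    obtain ⟨u, rfl⟩ : ∃ u, T (κ * u) = θ :=
      ⟨T.symm θ / κ, by rw [mul_div_cancel₀ _ hκ0.ne', T.apply_symm_apply]⟩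
    have hder : deriv (wFun1 V₀ (twoRampPrimitive A₁ b₁ A₂ b₂) κ) (T (κ * u)) =
        u - fFun σ V u + 1 / κ * k (fFun σ V u) := by
      rw [dw']
      simp only [T.symm_apply_apply]
      rw [hT, hfg]
      field_simp
      ring
    have hηQ : 0 ≤ min η₁ η₂ / Q := by positivity
    rw [hder]
    rcases le_total mstar u with hu | hu
    · have hT0 := hTm _ _ hu
      have hT1 := hTle _ _ hu
      rw [hTstar] at hT0 hT1
      have hfu := hfm hu
      rw [hfixstar] at hfu
      have hku : k (fFun σ V u) = A₁ * ramp (fFun σ V u - b₁) := by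
        rw [hk, twoRamp, ramp_of_nonpos (s := -fFun σ V u - b₂) (by linarith), mul_zero, sub_zero]
      have h1 : min η₁ η₂ / Q * (T (κ * u) - κ * mstar) ≤
          u - fFun σ V u + 1 / κ * k (fFun σ V u) := by
        calc _ ≤ min η₁ η₂ / Q * (Q * (u - mstar)) := mul_le_mul_of_nonneg_left hT1 hηQ
          _ = min η₁ η₂ * (u - mstar) := by field_simp
          _ ≤ η₁ * (u - mstar) := mul_le_mul_of_nonneg_right (min_le_left _ _) (by linarith)
          _ ≤ _ := by
            rw [hku]
            exact hcoer₁ u hu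
      nlinarith
    · have hT0 := hTm _ _ hu
      have hT1 := hTle _ _ hu
      rw [hTstar] at hT0 hT1
      have hfu := hfm hu
      rw [hfixstar] at hfu
      have hku : k (fFun σ V u) = -(A₂ * ramp (-fFun σ V u - b₂)) := by
        rw [hk, twoRamp, ramp_of_nonpos (s := fFun σ V u - b₁) (by linarith), mul_zero, zero_sub]
      have h1 : min η₁ η₂ / Q * (κ * mstar - T (κ * u)) ≤
          -(u - fFun σ V u + 1 / κ * k (fFun σ V u)) := by
        calc _ ≤ min η₁ η₂ / Q * (Q * (mstar - u)) := mul_le_mul_of_nonneg_left hT1 hηQ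
          _ = min η₁ η₂ * (mstar - u) := by field_simp
          _ ≤ η₂ * (mstar - u) := mul_le_mul_of_nonneg_right (min_le_right _ _) (by linarith)
          _ ≤ _ := by
            have := hcoer₂ (-u) (by linarith)
            rw [neg_neg] at this
            rw [hku]
            linarith
      nlinarith

end
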